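/- Let G be a group and n a natural number. Let 𝒢 be a subgroup of P_n(G) generated by a family of elements x₁, …, x_m, where each x_k has permutation part a transposition (i_k j_k) and tuple part the elementary element e_{i_k, j_k}(g_k) for some g_k ∈ G. If the transpositions (i_k j_k), k = 1, …, m, generate Equiv.Perm (Fin n), then there exists ψ ∈ (Fin n → G) such that the conjugate subgroup ψ·𝒢·ψ⁻¹ (conjugation inside P_n(G) by ψ with trivial permutation part) contains every permutation of Fin n (as an element with trivial tuple part). -/

import Mathlib

/-- Permutation action of `Equiv.Perm (Fin n)` on the direct power `Fin n → G`:
`(σ • f) i = f (σ⁻¹ i)`. -/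
def permAut (G : Type*) [Group G] (n : ℕ) :
    Equiv.Perm (Fin n) →* MulAut (Fin n → G) where
  toFun σ :=
    { toFun := fun f i => f (σ.symm i)
      invFun := fun f i => f (σ i)
      left_inv := fun f => funext fun i => by simp
      right_inv := fun f => funext fun i => by simp
      map_mul' := fun f g => rfl }
  map_one' := rfl
  map_mul' := fun σ τ => rfl

/-- `P_n(G) = (Fin n → G) ⋊ Equiv.Perm (Fin n)`. -/
abbrev Pn (G : Type*) [Group G] (n : ℕ) :=
  SemidirectProduct (Fin n → G) (Equiv.Perm (Fin n)) (permAut G n)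

/-- The element of `P_n(G)` with permutation part the transposition `(a b)` and tuple part
the elementary element `e_{a,b}(h)`. -/
def elemSwap {G : Type*} [Group G] {n : ℕ} (a b : Fin n) (h : G) : Pn G n :=
  ⟨fun l => if l = a then h else if l = b then h⁻¹ else 1, Equiv.swap a b⟩

theorem permAut_apply {G : Type*} [Group G] {n : ℕ} (σ : Equiv.Perm (Fin n))
    (f : Fin n → G) (l : Fin n) : permAut G n σ f l = f (σ.symm l) := rfl

theorem elemSwap_comm {G : Type*} [Group G] {n : ℕ} {a b : Fin n} (hab : a ≠ b) (h : G) :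
    (elemSwap b a h⁻¹ : Pn G n) = elemSwap a b h := by
  refine SemidirectProduct.ext ?_ (Equiv.swap_comm b a)
  funext l
  simp only [elemSwap]
  split_ifs <;> simp_all

theorem elemSwap_conj {G : Type*} [Group G] {n : ℕ} {a b c : Fin n} (hab : a ≠ b)
    (hbc : b ≠ c) (hac : a ≠ c) (h h' : G) :
    (elemSwap a b h * elemSwap b c h' * elemSwap a b h : Pn G n) = elemSwap a c (h * h') := by
  refine SemidirectProduct.ext ?_ ?_
  · funext l
    simp only [elemSwap, SemidirectProduct.mul_left, SemidirectProduct.mul_right, Pi.mul_apply,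
      permAut_apply, Equiv.symm_swap, map_mul, MulAut.mul_apply]
    rcases eq_or_ne l a with rfl | hla
    · simp [hbc.symm, hac.symm]
    rcases eq_or_ne l b with rfl | hlb
    · simp [hab, hbc, hac, hab.symm, Equiv.swap_apply_of_ne_of_ne]
    rcases eq_or_ne l c with rfl | hlc
    · simp [hab.symm, hbc.symm, hac.symm, Equiv.swap_apply_of_ne_of_ne]
    · simp [hla, hlb, hlc, Equiv.swap_apply_of_ne_of_ne]
  · change Equiv.swap a b * Equiv.swap b c * Equiv.swap a b = Equiv.swap a c
    rw [Equiv.swap_comm b c, Equiv.swap_comm a b,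
      Equiv.swap_mul_swap_mul_swap hbc.symm hac.symm]

theorem inl_conj_elemSwap {G : Type*} [Group G] {n : ℕ} {a b : Fin n} (hab : a ≠ b) {h : G}
    {ψ : Fin n → G} (hψ : ψ a * h = ψ b) :
    SemidirectProduct.inl ψ * elemSwap a b h * (SemidirectProduct.inl ψ)⁻¹ =
      (SemidirectProduct.inr (Equiv.swap a b) : Pn G n) := by
  rw [mul_inv_eq_iff_eq_mul]
  refine SemidirectProduct.ext ?_ ?_
  · funext l
    simp only [elemSwap, SemidirectProduct.mul_left, SemidirectProduct.left_inl,
      SemidirectProduct.right_inl, SemidirectProduct.left_inr, SemidirectProduct.right_inr,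
      Pi.mul_apply, permAut_apply, Equiv.symm_swap, map_one, MulAut.one_apply]
    rcases eq_or_ne l a with rfl | hla
    · simp [hψ]
    rcases eq_or_ne l b with rfl | hlb
    · simp [hab.symm, ← hψ]
    · simp [hla, hlb, Equiv.swap_apply_of_ne_of_ne]
  · simp [elemSwap]

/-- Two indices are linked by a subgroup `H` of `P_n(G)` if they are equal or `H` contains some
`elemSwap` exchanging them. -/
def Linked {G : Type*} [Group G] {n : ℕ} (H : Subgroup (Pn G n)) (a b : Fin n) : Prop :=
  a = b ∨ ∃ h : G, elemSwap a b h ∈ H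

theorem Linked.symm {G : Type*} [Group G] {n : ℕ} {H : Subgroup (Pn G n)} {a b : Fin n}
    (hab : Linked H a b) : Linked H b a := by
  rcases eq_or_ne a b with rfl | hne
  · exact Or.inl rfl
  · obtain ⟨h, hh⟩ := hab.resolve_left hne
    exact Or.inr ⟨h⁻¹, (elemSwap_comm hne h).symm ▸ hh⟩

theorem Linked.trans {G : Type*} [Group G] {n : ℕ} {H : Subgroup (Pn G n)} {a b c : Fin n}
    (hab : Linked H a b) (hbc : Linked H b c) : Linked H a c := by
  rcases eq_or_ne a b with rfl | hab'
  · exact hbc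
  rcases eq_or_ne b c with rfl | hbc'
  · exact hab
  rcases eq_or_ne a c with rfl | hac'
  · exact Or.inl rfl
  obtain ⟨h, hh⟩ := hab.resolve_left hab'
  obtain ⟨h', hh'⟩ := hbc.resolve_left hbc'
  exact Or.inr ⟨h * h', elemSwap_conj hab' hbc' hac' h h' ▸ H.mul_mem (H.mul_mem hh hh') hh⟩

theorem linked_swap_apply {G : Type*} [Group G] {n : ℕ} {H : Subgroup (Pn G n)} {a b : Fin n}
    (hab : Linked H a b) (c : Fin n) : Linked H c (Equiv.swap a b c) := by
  rcases eq_or_ne c a with rfl | hca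
  · simpa using hab
  rcases eq_or_ne c b with rfl | hcb
  · simpa using hab.symm
  · exact Or.inl (Equiv.swap_apply_of_ne_of_ne hca hcb).symm

theorem linked_of_closure_swap_eq_top {G : Type*} [Group G] {n : ℕ} {ι : Type*}
    {H : Subgroup (Pn G n)} {i j : ι → Fin n} (hH : ∀ k, Linked H (i k) (j k))
    (htop : Subgroup.closure (Set.range fun k => Equiv.swap (i k) (j k)) = ⊤) (a b : Fin n) :
    Linked H a b := by
  have key : ∀ σ : Equiv.Perm (Fin n), ∀ c, Linked H c (σ c) := by
    intro σ
    have hσ : σ ∈ Subgroup.closure (Set.range fun k => Equiv.swap (i k) (j k)) :=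
      htop ▸ Subgroup.mem_top σ
    induction hσ using Subgroup.closure_induction with
    | mem τ hτ =>
      obtain ⟨k, rfl⟩ := hτ
      exact linked_swap_apply (hH k)
    | one => exact fun c => Or.inl rfl
    | mul τ ρ _ _ hτ hρ => exact fun c => (hρ c).trans (hτ (ρ c))
    | inv τ _ hτ => exact fun c => by simpa using (hτ (τ⁻¹ c)).symm
  simpa using key (Equiv.swap a b) a

/-- The transpositions through a fixed point generate the symmetric group. -/
theorem eq_top_of_swap_mem {α : Type*} [Finite α] [DecidableEq α]
    {K : Subgroup (Equiv.Perm α)} (o : α) (hK : ∀ b, o ≠ b → Equiv.swap o b ∈ K) : K = ⊤ := by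
  rw [eq_top_iff, ← Equiv.Perm.closure_isSwap, Subgroup.closure_le]
  rintro _ ⟨a, b, hab, rfl⟩
  rcases eq_or_ne o a with rfl | hoa
  · exact hK b hab
  rcases eq_or_ne o b with rfl | hob
  · exact Equiv.swap_comm a o ▸ hK a hoa
  · rw [← Equiv.swap_mul_swap_mul_swap hob.symm hab.symm, Equiv.swap_comm b o]
    exact K.mul_mem (K.mul_mem (hK a hoa) (hK b hob)) (hK a hoa)

/-- Let `G` be a group and `n` a natural number.  Let `𝒢 ≤ P_n(G)` be
generated by a family of elements `x k`, where each `x k` has permutation part the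
transposition `(i k, j k)` (with `i k ≠ j k`) and tuple part the elementary element
`e_{i k, j k}(g k)`.  If the transpositions `(i k, j k)` generate `Equiv.Perm (Fin n)`,
then there exists `ψ : Fin n → G` such that the conjugate subgroup `ψ 𝒢 ψ⁻¹` (conjugation
inside `P_n(G)` by `ψ` with trivial permutation part) contains every permutation of
`Fin n` (as an element with trivial tuple part). -/
theorem stmt17 {G : Type*} [Group G] (n : ℕ) {ι : Type*}
    (i j : ι → Fin n) (g : ι → G) (hij : ∀ k : ι, i k ≠ j k)
    (x : ι → Pn G n)
    (hx : ∀ k : ι, x k =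
      ⟨(fun l : Fin n => if l = i k then g k else if l = j k then (g k)⁻¹ else 1),
        Equiv.swap (i k) (j k)⟩)
    (htrans : Subgroup.closure (Set.range fun k : ι => Equiv.swap (i k) (j k)) = ⊤)
    (𝒢 : Subgroup (Pn G n)) (h𝒢 : 𝒢 = Subgroup.closure (Set.range x)) :
    ∃ ψ : Fin n → G, ∀ σ : Equiv.Perm (Fin n),
      ∃ y ∈ 𝒢, SemidirectProduct.inl ψ * y * (SemidirectProduct.inl ψ)⁻¹ =
        (SemidirectProduct.inr σ : Pn G n) := by
  rcases isEmpty_or_nonempty (Fin n) with _ | ⟨⟨o⟩⟩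
  · exact ⟨1, fun σ => ⟨1, 𝒢.one_mem, by simp [Subsingleton.elim σ 1]⟩⟩
  have hlink : ∀ b, Linked 𝒢 o b := by
    refine linked_of_closure_swap_eq_top (fun k => Or.inr ⟨g k, ?_⟩) htrans o
    rw [h𝒢]
    exact Subgroup.subset_closure ⟨k, hx k⟩
  have hstar : ∀ b, ∃ h : G, o ≠ b → elemSwap o b h ∈ 𝒢 := fun b =>
    (hlink b).elim (fun hb => ⟨1, fun hne => absurd hb hne⟩) fun ⟨h, hh⟩ => ⟨h, fun _ => hh⟩
  choose h hh using hstar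
  let ψ : Fin n → G := Function.update h o 1
  let K : Subgroup (Equiv.Perm (Fin n)) :=
    (𝒢.map (MulAut.conj (SemidirectProduct.inl ψ : Pn G n)).toMonoidHom).comap
      SemidirectProduct.inr
  have hK : K = ⊤ := eq_top_of_swap_mem o fun b hb =>
    ⟨elemSwap o b (h b), hh b hb, inl_conj_elemSwap hb (by simp [ψ, hb.symm])⟩
  exact ⟨ψ, fun σ => (hK ▸ Subgroup.mem_top σ : σ ∈ K)⟩
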